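/- Let A_1, …, A_r be real m×m matrices, let γ > 0 and ρ⁻ ≥ 0 with ρ⁻ < γ, and let N_j (j = 0, 1, 2, …) be norms on ℝ^m satisfying N_{j+1}(x) = max{N_j(x), γ^{-1} max_{1≤i≤r} N_j(A_i x)} for all x, and such that for every j, min_{x≠0} (max_{1≤i≤r} N_j(A_i x))/N_j(x) = ρ⁻ and this minimum is attained. Define ω_j = {x ∈ ℝ^m : ρ⁻·N_j(x) = max_{1≤i≤r} N_j(A_i x)}. Then each ω_j is a closed cone, ω_{j+1} ⊆ ω_j for all j, the intersection ω = ∩_{j≥0} ω_j contains a nonzero vector, and N_j(x) = N_0(x) for every x ∈ ω and every j ≥ 0. -/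

import Mathlib

open Matrix Filter Topology Bornology Pointwise

/-- `N` is a norm on `ℝ^m`: nonnegative, definite, absolutely homogeneous, subadditive. -/
def IsNorm {m : ℕ} (N : (Fin m → ℝ) → ℝ) : Prop :=
  (∀ x, 0 ≤ N x) ∧ (∀ x, N x = 0 → x = 0) ∧
    (∀ (t : ℝ) (x), N (t • x) = |t| * N x) ∧ (∀ x y, N (x + y) ≤ N x + N y)

/-- `N` is a seminorm on `ℝ^m`. -/
def IsSeminorm {m : ℕ} (N : (Fin m → ℝ) → ℝ) : Prop :=
  (∀ x, 0 ≤ N x) ∧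
    (∀ (t : ℝ) (x), N (t • x) = |t| * N x) ∧ (∀ x y, N (x + y) ≤ N x + N y)

/-- The family `A` is irreducible: the matrices have no common invariant subspace
other than `⊥` and `⊤`. -/
def IsIrreducibleFamily {m r : ℕ} (A : Fin r → Matrix (Fin m) (Fin m) ℝ) : Prop :=
  ∀ W : Submodule ℝ (Fin m → ℝ), (∀ i, ∀ x ∈ W, (A i).mulVec x ∈ W) → W = ⊥ ∨ W = ⊤

/-- The operator norm of a matrix acting on `ℝ^m` (with its sup norm). -/
noncomputable def matNorm {m : ℕ} (M : Matrix (Fin m) (Fin m) ℝ) : ℝ :=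
  ‖LinearMap.toContinuousLinearMap M.mulVecLin‖

/-- The joint spectral radius of the family `A`:
`limsup_n (max over words of length n of the norm of the product)^(1/n)`. -/
noncomputable def jsr {m r : ℕ} (A : Fin r → Matrix (Fin m) (Fin m) ℝ) : ℝ :=
  Filter.atTop.limsup fun n : ℕ =>
    (⨆ w : Fin n → Fin r, matNorm (List.ofFn fun k => A (w k)).prod) ^ (1 / (n : ℝ))

/-- `maxA A N x = max_i N (A_i x)`. -/
noncomputable def maxA {m r : ℕ} (A : Fin r → Matrix (Fin m) (Fin m) ℝ)
    (N : (Fin m → ℝ) → ℝ) (x : Fin m → ℝ) : ℝ :=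
  ⨆ i, N ((A i).mulVec x)

/-- `ρ⁺ = max_{x ≠ 0} (max_i N (A_i x)) / N x`. -/
noncomputable def rhoSup {m r : ℕ} (A : Fin r → Matrix (Fin m) (Fin m) ℝ)
    (N : (Fin m → ℝ) → ℝ) : ℝ :=
  sSup ((fun x => maxA A N x / N x) '' {x | x ≠ 0})

/-- `ρ⁻ = min_{x ≠ 0} (max_i N (A_i x)) / N x`. -/
noncomputable def rhoInf {m r : ℕ} (A : Fin r → Matrix (Fin m) (Fin m) ℝ)
    (N : (Fin m → ℝ) → ℝ) : ℝ :=
  sInf ((fun x => maxA A N x / N x) '' {x | x ≠ 0})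

/-- An averaging function: continuous on positives, `γ t t = t`, and strictly
between `min` and `max` off the diagonal. -/
def IsAveraging (γ : ℝ → ℝ → ℝ) : Prop :=
  ContinuousOn (fun p : ℝ × ℝ => γ p.1 p.2) {p | 0 < p.1 ∧ 0 < p.2} ∧
    (∀ t, 0 < t → γ t t = t) ∧
    ∀ t s, 0 < t → 0 < s → t ≠ s → min t s < γ t s ∧ γ t s < max t s

/-- The max-relaxation iteration: `‖x‖_{n+1} = max (‖x‖_n, γ_n⁻¹ max_i ‖A_i x‖_n)`
where `γ_n = γ (ρ⁻_n, ρ⁺_n)`. -/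
noncomputable def iterN {m r : ℕ} (A : Fin r → Matrix (Fin m) (Fin m) ℝ)
    (γ : ℝ → ℝ → ℝ) (N0 : (Fin m → ℝ) → ℝ) : ℕ → (Fin m → ℝ) → ℝ
  | 0 => N0
  | n + 1 => fun x =>
      max (iterN A γ N0 n x)
        ((γ (rhoInf A (iterN A γ N0 n)) (rhoSup A (iterN A γ N0 n)))⁻¹ *
          maxA A (iterN A γ N0 n) x)

/-- The normalized norms `‖x‖°_n = ‖x‖_n / ‖e‖_n` of the max-relaxation iteration
(for `n = 0` this equals `‖x‖_0` since `‖e‖_0 = 1`). -/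
noncomputable def iterNnorm {m r : ℕ} (A : Fin r → Matrix (Fin m) (Fin m) ℝ)
    (γ : ℝ → ℝ → ℝ) (N0 : (Fin m → ℝ) → ℝ) (e : Fin m → ℝ) (n : ℕ) :
    (Fin m → ℝ) → ℝ :=
  fun x => iterN A γ N0 n x / iterN A γ N0 n e

/-- `e⁺(N, N') = max_{x ≠ 0} N x / N' x`. -/
noncomputable def ePlus {m : ℕ} (N N' : (Fin m → ℝ) → ℝ) : ℝ :=
  sSup ((fun x => N x / N' x) '' {x | x ≠ 0})

/-- `e⁻(N, N') = min_{x ≠ 0} N x / N' x`. -/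
noncomputable def eMinus {m : ℕ} (N N' : (Fin m → ℝ) → ℝ) : ℝ :=
  sInf ((fun x => N x / N' x) '' {x | x ≠ 0})

/-- The eccentricity of the norm `N` with respect to the norm `N'`. -/
noncomputable def ecc {m : ℕ} (N N' : (Fin m → ℝ) → ℝ) : ℝ :=
  ePlus N N' / eMinus N N'

/-- The set `ω = {x : ρ⁻ N x = max_i N (A_i x)}`. -/
def omegaSet {m r : ℕ} (A : Fin r → Matrix (Fin m) (Fin m) ℝ) (ρminus : ℝ)
    (N : (Fin m → ℝ) → ℝ) : Set (Fin m → ℝ) :=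
  {x | ρminus * N x = maxA A N x}

/-- A norm on `ℝ^m` is continuous. -/
theorem IsNorm.continuous {m : ℕ} {N : (Fin m → ℝ) → ℝ} (hN : IsNorm N) : Continuous N := by
  obtain ⟨-, -, hsmul, hadd⟩ := hN
  have hconv : ConvexOn ℝ Set.univ N := by
    refine ⟨convex_univ, fun x _ y _ a b ha hb _ => (hadd _ _).trans_eq ?_⟩
    rw [hsmul, hsmul, abs_of_nonneg ha, abs_of_nonneg hb, smul_eq_mul, smul_eq_mul]
  simpa [continuousOn_univ] using hconv.continuousOn isOpen_univ

theorem maxA_le_iff {m r : ℕ} (hr : 1 ≤ r) (A : Fin r → Matrix (Fin m) (Fin m) ℝ)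
    (N : (Fin m → ℝ) → ℝ) (x : Fin m → ℝ) (c : ℝ) :
    maxA A N x ≤ c ↔ ∀ i, N ((A i).mulVec x) ≤ c := by
  have : Nonempty (Fin r) := ⟨⟨0, hr⟩⟩
  exact ciSup_le_iff (Set.finite_range _).bddAbove

theorem le_maxA {m r : ℕ} (A : Fin r → Matrix (Fin m) (Fin m) ℝ)
    (N : (Fin m → ℝ) → ℝ) (x : Fin m → ℝ) (i : Fin r) :
    N ((A i).mulVec x) ≤ maxA A N x :=
  le_ciSup (f := fun i => N ((A i).mulVec x)) (Set.finite_range _).bddAbove i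

theorem mem_omegaSet_iff {m r : ℕ} (hr : 1 ≤ r) {A : Fin r → Matrix (Fin m) (Fin m) ℝ}
    {ρ : ℝ} {N : (Fin m → ℝ) → ℝ} (hlb : ∀ x, ρ * N x ≤ maxA A N x) (x : Fin m → ℝ) :
    x ∈ omegaSet A ρ N ↔ ∀ i, N ((A i).mulVec x) ≤ ρ * N x := by
  rw [← maxA_le_iff hr A N x]
  exact ⟨fun h => h.ge, fun h => le_antisymm (hlb x) h⟩

theorem isClosed_omegaSet {m r : ℕ} (hr : 1 ≤ r) {A : Fin r → Matrix (Fin m) (Fin m) ℝ}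
    {ρ : ℝ} {N : (Fin m → ℝ) → ℝ} (hN : IsNorm N) (hlb : ∀ x, ρ * N x ≤ maxA A N x) :
    IsClosed (omegaSet A ρ N) := by
  have hset : omegaSet A ρ N = ⋂ i, {x | N ((A i).mulVec x) ≤ ρ * N x} := by
    ext x
    simp [mem_omegaSet_iff hr hlb]
  rw [hset]
  exact isClosed_iInter fun i => isClosed_le
    (hN.continuous.comp (Continuous.matrix_mulVec continuous_const continuous_id))
    (continuous_const.mul hN.continuous)

theorem smul_mem_omegaSet {m r : ℕ} {A : Fin r → Matrix (Fin m) (Fin m) ℝ}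
    {ρ : ℝ} {N : (Fin m → ℝ) → ℝ} (hN : IsNorm N)
    {x : Fin m → ℝ} (hx : x ∈ omegaSet A ρ N) (t : ℝ) : t • x ∈ omegaSet A ρ N := by
  have hmax : maxA A N (t • x) = |t| * maxA A N x := by
    simp only [maxA, Matrix.mulVec_smul, hN.2.2.1, Real.mul_iSup_of_nonneg (abs_nonneg t)]
  change ρ * N x = maxA A N x at hx
  change ρ * N (t • x) = maxA A N (t • x)
  rw [hmax, hN.2.2.1, ← hx]
  ring

/-- On `ω` the relaxation step does not change the norm. -/
theorem max_eq_of_mem_omegaSet {m r : ℕ} {A : Fin r → Matrix (Fin m) (Fin m) ℝ}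
    {γ ρ : ℝ} (hγ : 0 < γ) (hlt : ρ < γ) {N : (Fin m → ℝ) → ℝ} (hN : IsNorm N)
    {x : Fin m → ℝ} (hx : x ∈ omegaSet A ρ N) :
    max (N x) (γ⁻¹ * maxA A N x) = N x := by
  change ρ * N x = maxA A N x at hx
  rw [← hx, max_eq_left]
  rw [inv_mul_le_iff₀ hγ]
  exact mul_le_mul_of_nonneg_right hlt.le (hN.1 x)

/-- The relaxation step shrinks `ω`. -/
theorem omegaSet_subset_of_relaxation {m r : ℕ} (hr : 1 ≤ r)
    {A : Fin r → Matrix (Fin m) (Fin m) ℝ} {γ ρ : ℝ} (hγ : 0 < γ) (hlt : ρ < γ)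
    {N N' : (Fin m → ℝ) → ℝ} (hN : IsNorm N)
    (hrec : ∀ x, N' x = max (N x) (γ⁻¹ * maxA A N x))
    (hlb : ∀ x, ρ * N x ≤ maxA A N x) :
    omegaSet A ρ N' ⊆ omegaSet A ρ N := by
  intro x hx
  change ρ * N' x = maxA A N' x at hx
  have hle : maxA A N x ≤ maxA A N' x := (maxA_le_iff hr A N x _).2 fun i =>
    (le_max_left _ _).trans ((hrec _).ge.trans (le_maxA A N' x i))
  refine le_antisymm (hlb x) ?_
  rcases le_total (γ⁻¹ * maxA A N x) (N x) with h | h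
  · rwa [← hx, hrec, max_eq_left h] at hle
  · rw [← hx, hrec, max_eq_right h] at hle
    have hN0 := hN.1 x
    rw [le_inv_mul_iff₀ hγ] at h
    have hmul : γ * maxA A N x ≤ ρ * maxA A N x := by
      calc γ * maxA A N x ≤ γ * (ρ * (γ⁻¹ * maxA A N x)) :=
            mul_le_mul_of_nonneg_left hle hγ.le
        _ = ρ * maxA A N x := by field_simp
    have hM : maxA A N x ≤ 0 := by nlinarith
    have hNx : N x = 0 := by nlinarith
    simpa [hNx] using hM

/-- A decreasing sequence of closed cones, each containing a nonzero vector, has a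
nonzero vector in its intersection. -/
theorem exists_ne_zero_mem_iInter_of_cones {m : ℕ} {K : ℕ → Set (Fin m → ℝ)}
    (hclosed : ∀ j, IsClosed (K j)) (hcone : ∀ j, ∀ x ∈ K j, ∀ t : ℝ, 0 ≤ t → t • x ∈ K j)
    (hanti : ∀ j, K (j + 1) ⊆ K j) (hne : ∀ j, ∃ x, x ≠ 0 ∧ x ∈ K j) :
    ∃ x, x ≠ 0 ∧ x ∈ ⋂ j, K j := by
  obtain ⟨x, hx⟩ := IsCompact.nonempty_iInter_of_sequence_nonempty_isCompact_isClosed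
    (fun j => K j ∩ Metric.sphere 0 1)
    (fun j => Set.inter_subset_inter_left _ (hanti j))
    (fun j => by
      obtain ⟨x, hx0, hx⟩ := hne j
      refine ⟨‖x‖⁻¹ • x, hcone j x hx _ (inv_nonneg.2 (norm_nonneg x)), ?_⟩
      rw [mem_sphere_zero_iff_norm, norm_smul, norm_inv, norm_norm,
        inv_mul_cancel₀ (norm_ne_zero_iff.2 hx0)])
    ((isCompact_sphere 0 1).inter_left (hclosed 0))
    (fun j => (hclosed j).inter Metric.isClosed_sphere)
  rw [Set.mem_iInter] at hx
  exact ⟨x, ne_zero_of_mem_unit_sphere (⟨x, (hx 0).2⟩ : Metric.sphere (0 : Fin m → ℝ) 1),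
    Set.mem_iInter.2 fun j => (hx j).1⟩

/-- for norms `N_j` with `N_{j+1} x = max (N_j x) (γ⁻¹ max_i N_j (A_i x))`,
`0 ≤ ρ⁻ < γ`, minimum of the ratio equal to `ρ⁻` and attained for each `j`, the sets
`ω_j = {x : ρ⁻ N_j x = max_i N_j (A_i x)}` are closed cones, are nested decreasing,
their intersection contains a nonzero vector, and `N_j = N_0` on the intersection. -/
theorem stmt14 {m r : ℕ} (hm : 1 ≤ m) (hr : 1 ≤ r)
    (A : Fin r → Matrix (Fin m) (Fin m) ℝ)
    (γ ρminus : ℝ) (hγ : 0 < γ) (hρ : 0 ≤ ρminus) (hlt : ρminus < γ)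
    (Nseq : ℕ → (Fin m → ℝ) → ℝ) (hN : ∀ j, IsNorm (Nseq j))
    (hrec : ∀ (j : ℕ) (x), Nseq (j + 1) x = max (Nseq j x) (γ⁻¹ * maxA A (Nseq j) x))
    (hlb : ∀ (j : ℕ) (x), ρminus * Nseq j x ≤ maxA A (Nseq j) x)
    (hatt : ∀ j : ℕ, ∃ x, x ≠ 0 ∧ maxA A (Nseq j) x = ρminus * Nseq j x) :
    (∀ j : ℕ, IsClosed (omegaSet A ρminus (Nseq j)) ∧
        ∀ x ∈ omegaSet A ρminus (Nseq j), ∀ t : ℝ, 0 ≤ t →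
          t • x ∈ omegaSet A ρminus (Nseq j)) ∧
      (∀ j : ℕ, omegaSet A ρminus (Nseq (j + 1)) ⊆ omegaSet A ρminus (Nseq j)) ∧
      (∃ x, x ≠ 0 ∧ x ∈ ⋂ j : ℕ, omegaSet A ρminus (Nseq j)) ∧
      ∀ x ∈ ⋂ j : ℕ, omegaSet A ρminus (Nseq j), ∀ j : ℕ, Nseq j x = Nseq 0 x := by
  have hcl j := isClosed_omegaSet hr (hN j) (hlb j)
  have hcone : ∀ j, ∀ x ∈ omegaSet A ρminus (Nseq j), ∀ t : ℝ, 0 ≤ t →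
      t • x ∈ omegaSet A ρminus (Nseq j) :=
    fun j x hx t _ => smul_mem_omegaSet (hN j) hx t
  have hanti j := omegaSet_subset_of_relaxation hr hγ hlt (hN j) (hrec j) (hlb j)
  refine ⟨fun j => ⟨hcl j, hcone j⟩, hanti,
    exists_ne_zero_mem_iInter_of_cones hcl hcone hanti fun j => ?_, fun x hx j => ?_⟩
  · obtain ⟨x, hx0, hx⟩ := hatt j
    exact ⟨x, hx0, hx.symm⟩
  · induction j with
    | zero => rfl
    | succ j ih =>
      rw [hrec, max_eq_of_mem_omegaSet hγ hlt (hN j) (Set.mem_iInter.1 hx j), ih]
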